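/- arXiv:1107.0849 — 5 statements merged into one kernel-verified Lean document; each statement's English description precedes it below -/
import Mathlib

section
/- Let n ≥ 2 be a natural number. For any real numbers β₁, …, βₙ with βₖ ∈ (0,2) for all k and β₁ + ⋯ + βₙ = 2, one has ∏_{k=1}^n Ψ₁(βₖ) ≤ (Ψ₁(2/n))^n. In other words, the product ∏ Ψ₁(βₖ) over the simplex {βₖ ∈ (0,2), ∑βₖ = 2} is maximized at the equal point β₁ = ⋯ = βₙ = 2/n. -/
open Real

/-- Ψ₁(β) = 2^(β²+6) · β^(β²+2) · (2−β)^(−(2−β)²/2) · (2+β)^(−(2+β)²/2). -/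
noncomputable def Psi1 (β : ℝ) : ℝ :=
  (2 : ℝ) ^ (β ^ 2 + 6) * β ^ (β ^ 2 + 2) *
    (2 - β) ^ (-((2 - β) ^ 2 / 2)) * (2 + β) ^ (-((2 + β) ^ 2 / 2))

/-- The logarithm of `Psi1` on `(0, 2)`. -/
noncomputable def logPsi1 (x : ℝ) : ℝ :=
  (x ^ 2 + 6) * log 2 + (x ^ 2 + 2) * log x - (2 - x) ^ 2 / 2 * log (2 - x)
    - (2 + x) ^ 2 / 2 * log (2 + x)

/-- The derivative of `logPsi1` on `(0, 2)`. -/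
noncomputable def logPsi1Deriv (x : ℝ) : ℝ :=
  2 * x * log 2 + 2 * x * log x + 2 / x + (2 - x) * log (2 - x) - (2 + x) * log (2 + x)

/-- The second derivative of `logPsi1` on `(0, 2)`. -/
noncomputable def logPsi1Deriv2 (x : ℝ) : ℝ :=
  2 * log 2 + 2 * log x - 2 / x ^ 2 - log (2 - x) - log (2 + x)

lemma Psi1_eq_exp_logPsi1 {x : ℝ} (hx : x ∈ Set.Ioo (0 : ℝ) 2) : Psi1 x = exp (logPsi1 x) := by
  obtain ⟨h0, h2⟩ := hx
  rw [Psi1, rpow_def_of_pos two_pos, rpow_def_of_pos h0, rpow_def_of_pos (sub_pos.2 h2),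
    rpow_def_of_pos (by linarith : 0 < 2 + x), ← exp_add, ← exp_add, ← exp_add, logPsi1]
  congr 1
  ring

lemma hasDerivAt_logPsi1 {x : ℝ} (hx : x ∈ Set.Ioo (0 : ℝ) 2) :
    HasDerivAt logPsi1 (logPsi1Deriv x) x := by
  obtain ⟨h0, h2⟩ := hx
  have hs : 2 - x ≠ 0 := by linarith
  have ha : 2 + x ≠ 0 := by linarith
  have dx := hasDerivAt_id x
  have dsub := dx.const_sub 2
  have dadd := dx.const_add 2
  have d := (((((dx.pow 2).add_const 6).mul_const (log 2)).add
    (((dx.pow 2).add_const 2).mul (dx.log h0.ne'))).sub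
    (((dsub.pow 2).div_const 2).mul (dsub.log hs))).sub
    (((dadd.pow 2).div_const 2).mul (dadd.log ha))
  refine d.congr_deriv ?_
  simp only [logPsi1Deriv, id, Pi.pow_apply]
  field_simp
  ring

lemma hasDerivAt_logPsi1Deriv {x : ℝ} (hx : x ∈ Set.Ioo (0 : ℝ) 2) :
    HasDerivAt logPsi1Deriv (logPsi1Deriv2 x) x := by
  obtain ⟨h0, h2⟩ := hx
  have hs : 2 - x ≠ 0 := by linarith
  have ha : 2 + x ≠ 0 := by linarith
  have dx := hasDerivAt_id x
  have dsub := dx.const_sub 2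
  have dadd := dx.const_add 2
  have d := (((((dx.const_mul 2).mul_const (log 2)).add
    ((dx.const_mul 2).mul (dx.log h0.ne'))).add
    ((hasDerivAt_const x (2 : ℝ)).div dx h0.ne')).add
    (dsub.mul (dsub.log hs))).sub (dadd.mul (dadd.log ha))
  refine d.congr_deriv ?_
  simp only [logPsi1Deriv2, id]
  field_simp
  ring

lemma logPsi1Deriv2_add_nonpos {x y : ℝ} (hx : 0 < x) (hy : 0 < y) (hxy : x + y ≤ 2) :
    logPsi1Deriv2 x + logPsi1Deriv2 y ≤ 0 := by
  have h1 : log y ≤ log (2 - x) := log_le_log hy (by linarith)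
  have h2 : log x ≤ log (2 - y) := log_le_log hx (by linarith)
  have h3 : log 2 ≤ log (2 + x) := log_le_log two_pos (by linarith)
  have h4 : log 2 ≤ log (2 + y) := log_le_log two_pos (by linarith)
  have h5 : log x ≤ x - 1 := log_le_sub_one_of_pos hx
  have h6 : log y ≤ y - 1 := log_le_sub_one_of_pos hy
  have h7 : log 2 ≤ 1 := by linarith [log_le_sub_one_of_pos (two_pos : (0 : ℝ) < 2)]
  have tangent (z : ℝ) (hz : 0 < z) : 6 - 4 * z ≤ 2 / z ^ 2 := by
    rw [le_div_iff₀ (by positivity)]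
    nlinarith [mul_nonneg (sq_nonneg (z - 1)) (by linarith : 0 ≤ 2 * z + 1)]
  have h8 := tangent x hx
  have h9 := tangent y hy
  unfold logPsi1Deriv2
  linarith

lemma concaveOn_logPsi1 : ConcaveOn ℝ (Set.Ioc 0 1) logPsi1 := by
  have mem {x : ℝ} (hx : x ∈ Set.Ioc (0 : ℝ) 1) : x ∈ Set.Ioo (0 : ℝ) 2 :=
    ⟨hx.1, by linarith [hx.2]⟩
  refine concaveOn_of_hasDerivWithinAt2_nonpos (f' := logPsi1Deriv) (f'' := logPsi1Deriv2)
    (convex_Ioc 0 1) (fun x hx ↦ (hasDerivAt_logPsi1 (mem hx)).continuousAt.continuousWithinAt)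
    (fun x hx ↦ (hasDerivAt_logPsi1 (mem (interior_subset hx))).hasDerivWithinAt)
    (fun x hx ↦ (hasDerivAt_logPsi1Deriv (mem (interior_subset hx))).hasDerivWithinAt)
    (fun x hx ↦ ?_)
  obtain ⟨h0, h1⟩ := interior_subset hx
  linarith [logPsi1Deriv2_add_nonpos h0 h0 (by linarith)]

lemma logPsi1_add_le {x y : ℝ} (hx : 0 < x) (hy : 0 < y) (hxy : x + y ≤ 2) :
    logPsi1 x + logPsi1 y ≤ 2 * logPsi1 ((x + y) / 2) := by
  set m := (x + y) / 2 with hm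
  have add_mem {t : ℝ} (ht : t ∈ Set.Ioo (-m) m) : m + t ∈ Set.Ioo (0 : ℝ) 2 :=
    ⟨by linarith [ht.1], by linarith [ht.2]⟩
  have sub_mem {t : ℝ} (ht : t ∈ Set.Ioo (-m) m) : m - t ∈ Set.Ioo (0 : ℝ) 2 :=
    ⟨by linarith [ht.2], by linarith [ht.1]⟩
  have d1 {t : ℝ} (ht : t ∈ Set.Ioo (-m) m) :
      HasDerivAt (fun t ↦ logPsi1 (m + t) + logPsi1 (m - t))
        (logPsi1Deriv (m + t) - logPsi1Deriv (m - t)) t := by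
    simpa [sub_eq_add_neg] using ((hasDerivAt_logPsi1 (add_mem ht)).comp_const_add m t).fun_add
      ((hasDerivAt_logPsi1 (sub_mem ht)).comp_const_sub m t)
  have d2 {t : ℝ} (ht : t ∈ Set.Ioo (-m) m) :
      HasDerivAt (fun t ↦ logPsi1Deriv (m + t) - logPsi1Deriv (m - t))
        (logPsi1Deriv2 (m + t) + logPsi1Deriv2 (m - t)) t := by
    simpa using ((hasDerivAt_logPsi1Deriv (add_mem ht)).comp_const_add m t).fun_sub
      ((hasDerivAt_logPsi1Deriv (sub_mem ht)).comp_const_sub m t)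
  have hconc : ConcaveOn ℝ (Set.Ioo (-m) m) (fun t ↦ logPsi1 (m + t) + logPsi1 (m - t)) :=
    concaveOn_of_hasDerivWithinAt2_nonpos (convex_Ioo _ _)
      (fun t ht ↦ (d1 ht).continuousAt.continuousWithinAt)
      (fun t ht ↦ (d1 (interior_subset ht)).hasDerivWithinAt)
      (fun t ht ↦ (d2 (interior_subset ht)).hasDerivWithinAt)
      (fun t ht ↦ logPsi1Deriv2_add_nonpos (add_mem (interior_subset ht)).1
        (sub_mem (interior_subset ht)).1 (by linarith))
  have key := hconc.2 (x := (x - y) / 2) (y := (y - x) / 2) ⟨by linarith, by linarith⟩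
    ⟨by linarith, by linarith⟩ (by norm_num : (0 : ℝ) ≤ 1 / 2) (by norm_num : (0 : ℝ) ≤ 1 / 2)
    (by norm_num)
  have e1 : m + (x - y) / 2 = x := by rw [hm]; ring
  have e2 : m - (x - y) / 2 = y := by rw [hm]; ring
  have e3 : m + (y - x) / 2 = y := by rw [hm]; ring
  have e4 : m - (y - x) / 2 = x := by rw [hm]; ring
  have e5 : (1 / 2 : ℝ) * ((x - y) / 2) + 1 / 2 * ((y - x) / 2) = 0 := by ring
  simp only [smul_eq_mul, e1, e2, e3, e4, e5, add_zero, sub_zero] at key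
  linarith

lemma sum_logPsi1_le_of_le_one {n : ℕ} (hn : n ≠ 0) {β : Fin n → ℝ}
    (hβ : ∀ k, β k ∈ Set.Ioc (0 : ℝ) 1) (hsum : ∑ k, β k = 2) :
    ∑ k, logPsi1 (β k) ≤ n * logPsi1 (2 / n) := by
  have hn' : (0 : ℝ) < n := by positivity
  have key := concaveOn_logPsi1.le_map_sum (t := Finset.univ) (w := fun _ : Fin n ↦ (n : ℝ)⁻¹)
    (p := β) (fun _ _ ↦ by positivity) (by simp [hn'.ne']) (fun k _ ↦ hβ k)
  simp only [smul_eq_mul, ← Finset.mul_sum, hsum] at key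
  rwa [inv_mul_le_iff₀ hn', inv_mul_eq_div] at key

lemma sum_logPsi1_le {n : ℕ} (hn : 2 ≤ n) {β : Fin n → ℝ}
    (hβ : ∀ k, 0 < β k) (hsum : ∑ k, β k = 2) :
    ∑ k, logPsi1 (β k) ≤ n * logPsi1 (2 / n) := by
  by_cases hle : ∀ k, β k ≤ 1
  · exact sum_logPsi1_le_of_le_one (by lia) (fun k ↦ ⟨hβ k, hle k⟩) hsum
  push Not at hle
  obtain ⟨j, hj⟩ := hle
  have : Nontrivial (Fin n) := Fin.nontrivial_iff_two_le.2 hn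
  obtain ⟨k, hk⟩ := exists_ne j
  have hpair (i : Fin n) (hi : i ≠ j) : β i + β j ≤ 2 := by
    rw [← hsum, ← Finset.sum_pair hi]
    exact Finset.sum_le_univ_sum_of_nonneg fun i ↦ (hβ i).le
  set m := (β k + β j) / 2 with hm
  let γ : Fin n → ℝ := fun i ↦ if i = k ∨ i = j then m else β i
  have hdiff (h : ℝ → ℝ) :
      ∑ i, (h (γ i) - h (β i)) = (h m - h (β k)) + (h m - h (β j)) := by
    rw [Fintype.sum_eq_add k j hk fun i hi ↦ by simp [γ, hi.1, hi.2]]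
    simp [γ]
  have hγ (i : Fin n) : γ i ∈ Set.Ioc (0 : ℝ) 1 := by
    by_cases hi : i = k ∨ i = j
    · simp only [γ, if_pos hi]
      exact ⟨by linarith [hβ k, hβ j], by linarith [hpair k hk]⟩
    · simp only [γ, if_neg hi]
      exact ⟨hβ i, by linarith [hpair i fun h ↦ hi (Or.inr h)]⟩
  have hγsum : ∑ i, γ i = 2 := by
    have h := hdiff id
    simp only [id, Finset.sum_sub_distrib] at h
    linarith
  have h := hdiff logPsi1
  rw [Finset.sum_sub_distrib] at h
  linarith [logPsi1_add_le (hβ k) (hβ j) (hpair k hk),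
    sum_logPsi1_le_of_le_one (by lia) hγ hγsum]

theorem psi1_prod_le (n : ℕ) (hn : 2 ≤ n) (β : Fin n → ℝ)
    (hβ : ∀ k, β k ∈ Set.Ioo (0 : ℝ) 2) (hsum : ∑ k, β k = 2) :
    ∏ k, Psi1 (β k) ≤ (Psi1 (2 / n)) ^ n := by
  have hn' : (2 : ℝ) ≤ n := by exact_mod_cast hn
  have hmem : (2 / n : ℝ) ∈ Set.Ioo (0 : ℝ) 2 :=
    ⟨by positivity, by rw [div_lt_iff₀ (by linarith)]; linarith⟩
  rw [Finset.prod_congr rfl fun k _ ↦ Psi1_eq_exp_logPsi1 (hβ k), Psi1_eq_exp_logPsi1 hmem,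
    ← exp_sum, ← exp_nat_mul, exp_le_exp]
  exact sum_logPsi1_le hn (fun k ↦ (hβ k).1) hsum
end

section
/- Let n ≥ 2 be a natural number. For any real numbers β₁, …, βₙ with βₖ ∈ (0,√2) for all k and β₁ + ⋯ + βₙ = √2, one has ∏_{k=1}^n Ψ₂(βₖ) ≤ (Ψ₂(√2/n))^n. In other words, the product ∏ Ψ₂(βₖ) over the simplex {βₖ ∈ (0,√2), ∑βₖ = √2} is maximized at the equal point β₁ = ⋯ = βₙ = √2/n. -/
open Real

/-- Ψ₂(β) = 8 · β^(2β²+2) · |1−β|^(−(1−β)²) · (1+β)^(−(1+β)²) for β ≠ 1, Ψ₂(1) = 1/2. -/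
noncomputable def Psi2 (β : ℝ) : ℝ :=
  if β = 1 then 1 / 2
  else 8 * β ^ (2 * β ^ 2 + 2) * |1 - β| ^ (-((1 - β) ^ 2)) * (1 + β) ^ (-((1 + β) ^ 2))

/-- The logarithm of `Psi2`; the convention `log x = log |x|` takes care of `β > 1`. -/
noncomputable def logPsi2 (β : ℝ) : ℝ :=
  log 8 + (2 * β ^ 2 + 2) * log β - (1 - β) ^ 2 * log (1 - β) - (1 + β) ^ 2 * log (1 + β)

/-- The derivative of `logPsi2` on the positive reals different from `1`. -/
noncomputable def derivLogPsi2 (β : ℝ) : ℝ :=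
  4 * (β * log β) + 2 / β + 2 * ((1 - β) * log (1 - β)) - 2 * ((1 + β) * log (1 + β))

lemma psi2_eq_exp_logPsi2 {β : ℝ} (hβ : 0 < β) : Psi2 β = exp (logPsi2 β) := by
  unfold Psi2 logPsi2
  split_ifs with h
  · have h8 : log 8 = 3 * log 2 := by
      rw [show (8 : ℝ) = 2 ^ 3 by norm_num, log_pow]; norm_num
    rw [h, show log 8 + (2 * (1 : ℝ) ^ 2 + 2) * log 1 - (1 - 1) ^ 2 * log (1 - 1)
      - (1 + 1) ^ 2 * log (1 + 1) = -log 2 by rw [h8]; norm_num; ring,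
      exp_neg, exp_log two_pos]
    norm_num
  · have h1 : 0 < |1 - β| := abs_pos.2 (sub_ne_zero.2 (Ne.symm h))
    rw [rpow_def_of_pos hβ, rpow_def_of_pos h1, rpow_def_of_pos (by linarith : 0 < 1 + β),
      log_abs]
    nth_rewrite 1 [← exp_log (by norm_num : (0 : ℝ) < 8)]
    rw [← exp_add, ← exp_add, ← exp_add]
    congr 1
    ring

lemma hasDerivAt_logPsi2 {β : ℝ} (h0 : 0 < β) (h1 : β ≠ 1) :
    HasDerivAt logPsi2 (derivLogPsi2 β) β := by
  have hs : (1 - β) ≠ 0 := sub_ne_zero.2 (Ne.symm h1)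
  have ha : (1 + β) ≠ 0 := by positivity
  have hid := hasDerivAt_id' β
  have d1 := (((hid.pow 2).const_mul 2).add_const 2).mul (hid.log h0.ne')
  have d2 := ((hid.const_sub 1).pow 2).mul ((hid.const_sub 1).log hs)
  have d3 := ((hid.const_add 1).pow 2).mul ((hid.const_add 1).log ha)
  refine HasDerivAt.congr_deriv (f := logPsi2) (((d1.const_add (log 8)).sub d2).sub d3) ?_
  simp only [derivLogPsi2, Pi.pow_apply]
  field_simp
  ring

lemma hasDerivAt_derivLogPsi2 {β : ℝ} (h0 : 0 < β) (h1 : β ≠ 1) :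
    HasDerivAt derivLogPsi2
      (4 * log β - 2 / β ^ 2 - 2 * log (1 - β) - 2 * log (1 + β)) β := by
  have hs : (1 - β) ≠ 0 := sub_ne_zero.2 (Ne.symm h1)
  have ha : (1 + β) ≠ 0 := by positivity
  have hid := hasDerivAt_id' β
  have d1 := (hid.mul (hid.log h0.ne')).const_mul 4
  have d2 := (hid.inv h0.ne').const_mul 2
  have d3 := ((hid.const_sub 1).mul ((hid.const_sub 1).log hs)).const_mul 2
  have d4 := ((hid.const_add 1).mul ((hid.const_add 1).log ha)).const_mul 2
  refine HasDerivAt.congr_deriv (f := derivLogPsi2) (((d1.add d2).add d3).sub d4) ?_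
  field_simp
  ring

lemma continuousOn_logPsi2 : ContinuousOn logPsi2 (Set.Ioi 0) := by
  have h1 : Continuous fun β : ℝ => (1 - β) * ((1 - β) * log (1 - β)) :=
    (by fun_prop : Continuous fun β : ℝ => 1 - β).mul
      (continuous_mul_log.comp (by fun_prop : Continuous fun β : ℝ => 1 - β))
  have h2 : Continuous fun β : ℝ => (1 + β) * ((1 + β) * log (1 + β)) :=
    (by fun_prop : Continuous fun β : ℝ => 1 + β).mul
      (continuous_mul_log.comp (by fun_prop : Continuous fun β : ℝ => 1 + β))
  have h3 : ContinuousOn log (Set.Ioi 0) :=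
    continuousOn_log.mono fun x hx => (Set.mem_Ioi.1 hx).ne'
  have h4 : ContinuousOn (fun β : ℝ => log 8 + (2 * β ^ 2 + 2) * log β) (Set.Ioi 0) := by
    fun_prop
  refine ((h4.sub h1.continuousOn).sub h2.continuousOn).congr fun β _ => ?_
  simp only [logPsi2, Pi.sub_apply]
  ring

lemma continuousOn_derivLogPsi2 : ContinuousOn derivLogPsi2 (Set.Ioi 0) := by
  have h1 : Continuous fun β : ℝ => (1 - β) * log (1 - β) :=
    continuous_mul_log.comp (by fun_prop : Continuous fun β : ℝ => 1 - β)
  have h2 : Continuous fun β : ℝ => (1 + β) * log (1 + β) :=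
    continuous_mul_log.comp (by fun_prop : Continuous fun β : ℝ => 1 + β)
  have h3 : Continuous fun β : ℝ => β * log β := continuous_mul_log
  have h4 : ContinuousOn (fun β : ℝ => 2 / β) (Set.Ioi 0) :=
    continuousOn_const.div continuousOn_id fun x hx => (Set.mem_Ioi.1 hx).ne'
  exact (((h3.continuousOn.const_mul 4).add h4).add (h1.continuousOn.const_mul 2)).sub
    (h2.continuousOn.const_mul 2)

/-- Comparing integer powers of `x` and `2` bounds `log x` by a rational multiple of `log 2`. -/
lemma mul_log_le_mul_log_two {x : ℝ} (hx : 0 < x) (m k : ℕ) (h : x ^ m ≤ 2 ^ k) :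
    m * log x ≤ k * log 2 := by
  rw [← log_pow, ← log_pow]
  exact log_le_log (by positivity) h

lemma mul_log_two_le_mul_log {x : ℝ} (m k : ℕ) (h : 2 ^ k ≤ x ^ m) :
    k * log 2 ≤ m * log x := by
  rw [← log_pow, ← log_pow]
  exact log_le_log (by positivity) h

lemma antitoneOn_derivLogPsi2 : AntitoneOn derivLogPsi2 (Set.Ioc 0 (7 / 8)) := by
  refine antitoneOn_of_deriv_nonpos (convex_Ioc _ _)
    (continuousOn_derivLogPsi2.mono fun x hx => hx.1) ?_ ?_
  · intro x hx
    rw [interior_Ioc] at hx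
    exact (hasDerivAt_derivLogPsi2 hx.1
      (by linarith [hx.2])).differentiableAt.differentiableWithinAt
  · intro x hx
    rw [interior_Ioc] at hx
    obtain ⟨h0, h1⟩ := hx
    rw [(hasDerivAt_derivLogPsi2 h0 (by linarith)).deriv]
    have hs : 0 < 1 - x := by linarith
    have ha : 0 < 1 + x := by linarith
    have hx2 : x ^ 2 ≤ 49 / 64 := by nlinarith
    have hlog : 2 * log x - log (1 - x) - log (1 + x) ≤ log (49 / 15) := by
      have : 2 * log x - log (1 - x) - log (1 + x) = log (x ^ 2 / (1 - x) / (1 + x)) := by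
        rw [log_div (by positivity) ha.ne', log_div (by positivity) hs.ne', log_pow]
        norm_num
      rw [this]
      refine log_le_log (by positivity) ?_
      rw [div_div, div_le_iff₀ (by positivity)]
      nlinarith
    have hnum := mul_log_le_mul_log_two (x := 49 / 15) (by norm_num) 4 7 (by norm_num)
    push_cast at hnum
    have hinv : 128 / 49 ≤ 2 / x ^ 2 := by
      rw [div_le_div_iff₀ (by norm_num) (by positivity)]
      linarith
    linarith [log_two_lt_d9]

lemma deriv_logPsi2_of_lt {x : ℝ} (h0 : 0 < x) (h1 : x < 1) :
    deriv logPsi2 x = derivLogPsi2 x :=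
  (hasDerivAt_logPsi2 h0 h1.ne).deriv

lemma concaveOn_logPsi2 : ConcaveOn ℝ (Set.Ioc 0 (7 / 8)) logPsi2 := by
  refine AntitoneOn.concaveOn_of_deriv (convex_Ioc _ _)
    (continuousOn_logPsi2.mono fun x hx => hx.1) ?_ ?_
  · intro x hx
    rw [interior_Ioc] at hx
    exact (hasDerivAt_logPsi2 hx.1
      (by linarith [hx.2])).differentiableAt.differentiableWithinAt
  · rw [interior_Ioc]
    intro x hx y hy hxy
    rw [deriv_logPsi2_of_lt hx.1 (by linarith [hx.2]),
      deriv_logPsi2_of_lt hy.1 (by linarith [hy.2])]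
    exact antitoneOn_derivLogPsi2 ⟨hx.1, hx.2.le⟩ ⟨hy.1, hy.2.le⟩ hxy

lemma derivLogPsi2_five_ninths_nonneg : 0 ≤ derivLogPsi2 (5 / 9) := by
  have h1 := mul_log_le_mul_log_two (x := 14 / 9) (by norm_num) 3 2 (by norm_num)
  have h2 := mul_log_le_mul_log_two (x := 9 / 5) (by norm_num) 7 6 (by norm_num)
  have h3 := mul_log_le_mul_log_two (x := 9 / 4) (by norm_num) 5 6 (by norm_num)
  have e2 : log (5 / 9) = -log (9 / 5) := by rw [← log_inv]; norm_num
  have e3 : log (4 / 9) = -log (9 / 4) := by rw [← log_inv]; norm_num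
  push_cast at h1 h2 h3
  unfold derivLogPsi2
  norm_num
  rw [e2, e3]
  linarith [log_two_lt_d9]

lemma monotoneOn_logPsi2 : MonotoneOn logPsi2 (Set.Ioc 0 (5 / 9)) := by
  refine monotoneOn_of_deriv_nonneg (convex_Ioc _ _)
    (continuousOn_logPsi2.mono fun x hx => hx.1) ?_ ?_
  · intro x hx
    rw [interior_Ioc] at hx
    exact (hasDerivAt_logPsi2 hx.1
      (by linarith [hx.2])).differentiableAt.differentiableWithinAt
  · intro x hx
    rw [interior_Ioc] at hx
    rw [deriv_logPsi2_of_lt hx.1 (by linarith [hx.2])]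
    exact derivLogPsi2_five_ninths_nonneg.trans (antitoneOn_derivLogPsi2
      ⟨hx.1, by linarith [hx.2]⟩ ⟨by norm_num, by norm_num⟩ hx.2.le)

lemma antitoneOn_logPsi2_left : AntitoneOn logPsi2 (Set.Icc (7 / 8) 1) := by
  refine antitoneOn_of_deriv_nonpos (convex_Icc _ _)
    (continuousOn_logPsi2.mono fun x hx => Set.mem_Ioi.2 (by linarith [hx.1])) ?_ ?_
  · intro x hx
    rw [interior_Icc] at hx
    exact (hasDerivAt_logPsi2 (by linarith [hx.1])
      hx.2.ne).differentiableAt.differentiableWithinAt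
  · intro x hx
    rw [interior_Icc] at hx
    obtain ⟨h0, h1⟩ := hx
    have hx0 : 0 < x := by linarith
    rw [deriv_logPsi2_of_lt hx0 h1]
    have e1 : x * log x ≤ 0 := mul_nonpos_of_nonneg_of_nonpos hx0.le (log_nonpos hx0.le h1.le)
    have e2 : (1 - x) * log (1 - x) ≤ 0 := mul_nonpos_of_nonneg_of_nonpos (by linarith)
      (log_nonpos (by linarith) (by linarith))
    have e3 : 2 / x ≤ 16 / 7 := by
      rw [div_le_div_iff₀ hx0 (by norm_num)]
      linarith
    have e4 : (15 / 8) * log (15 / 8) ≤ (1 + x) * log (1 + x) := by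
      have := log_le_log (by norm_num) (by linarith : (15 / 8 : ℝ) ≤ 1 + x)
      have hpos : 0 ≤ log (15 / 8) := log_nonneg (by norm_num)
      gcongr
      linarith
    have e5 := mul_log_two_le_mul_log (x := 15 / 8) 9 8 (by norm_num)
    push_cast at e5
    unfold derivLogPsi2
    linarith [log_two_gt_d9]

lemma derivLogPsi2_sqrt_two_nonpos : derivLogPsi2 (√2) ≤ 0 := by
  have hsq : √2 * √2 = 2 := mul_self_sqrt (by norm_num)
  have hlo : 1.414 ≤ √2 := le_sqrt_of_sq_le (by norm_num)
  have hhi : √2 ≤ 1.415 := sqrt_le_iff.2 ⟨by norm_num, by norm_num⟩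
  have e1 : log (√2) = log 2 / 2 := log_sqrt (by norm_num)
  have e2 : log (1 - √2) = -log (1 + √2) := by
    rw [← log_inv, ← log_neg_eq_log (1 - √2)]
    congr 1
    refine eq_inv_of_mul_eq_one_left ?_
    linarith
  have e3 : 2 / √2 = √2 := by
    rw [div_eq_iff (by positivity)]
    exact hsq.symm
  have e4 := mul_log_two_le_mul_log (x := 12 / 5) 8 10 (by norm_num)
  have e5 : log (12 / 5) ≤ log (1 + √2) := log_le_log (by norm_num) (by linarith)
  push_cast at e4
  unfold derivLogPsi2
  rw [e1, e2, e3]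
  have e6 : √2 * log 2 ≤ 1.415 * log 2 := by
    have := log_nonneg (by norm_num : (1 : ℝ) ≤ 2)
    gcongr
  linarith [log_two_gt_d9, log_two_lt_d9]

lemma monotoneOn_derivLogPsi2 : MonotoneOn derivLogPsi2 (Set.Icc 1 (√2)) := by
  refine monotoneOn_of_deriv_nonneg (convex_Icc _ _)
    (continuousOn_derivLogPsi2.mono fun x hx => Set.mem_Ioi.2 (by linarith [hx.1])) ?_ ?_
  · intro x hx
    rw [interior_Icc] at hx
    exact (hasDerivAt_derivLogPsi2 (by linarith [hx.1])
      hx.1.ne').differentiableAt.differentiableWithinAt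
  · intro x hx
    rw [interior_Icc] at hx
    have h1 : 1 < x := hx.1
    have h0 : 0 < x := by linarith
    rw [(hasDerivAt_derivLogPsi2 h0 h1.ne').deriv]
    have hs : 0 < x - 1 := by linarith
    have ha : 0 < 1 + x := by linarith
    have hlog : log (x - 1) + log (1 + x) - 2 * log x ≤ (x - 1) * (1 + x) / x ^ 2 - 1 := by
      have : log (x - 1) + log (1 + x) - 2 * log x = log ((x - 1) * (1 + x) / x ^ 2) := by
        rw [log_div (by positivity) (by positivity), log_mul hs.ne' ha.ne', log_pow]
        norm_num
      rw [this]
      exact log_le_sub_one_of_pos (by positivity)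
    have hneg : log (1 - x) = log (x - 1) := by rw [← log_neg_eq_log, neg_sub]
    have hfrac : (x - 1) * (1 + x) / x ^ 2 - 1 = -(2 / x ^ 2) / 2 := by
      field_simp
      ring
    rw [hneg]
    linarith

lemma antitoneOn_logPsi2_right : AntitoneOn logPsi2 (Set.Icc 1 (√2)) := by
  refine antitoneOn_of_deriv_nonpos (convex_Icc _ _)
    (continuousOn_logPsi2.mono fun x hx => Set.mem_Ioi.2 (by linarith [hx.1])) ?_ ?_
  · intro x hx
    rw [interior_Icc] at hx
    exact (hasDerivAt_logPsi2 (by linarith [hx.1])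
      hx.1.ne').differentiableAt.differentiableWithinAt
  · intro x hx
    rw [interior_Icc] at hx
    rw [(hasDerivAt_logPsi2 (by linarith [hx.1]) hx.1.ne').deriv]
    exact (monotoneOn_derivLogPsi2 ⟨hx.1.le, hx.2.le⟩ ⟨(hx.1.trans hx.2).le, le_rfl⟩
      hx.2.le).trans derivLogPsi2_sqrt_two_nonpos

lemma logPsi2_le_seven_eighths {x : ℝ} (h0 : 7 / 8 ≤ x) (h1 : x ≤ √2) :
    logPsi2 x ≤ logPsi2 (7 / 8) := by
  rcases le_total x 1 with h | h
  · exact antitoneOn_logPsi2_left ⟨le_rfl, by norm_num⟩ ⟨h0, h⟩ h0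
  · exact (antitoneOn_logPsi2_right ⟨le_rfl, h.trans h1⟩ ⟨h, h1⟩ h).trans
      (antitoneOn_logPsi2_left ⟨le_rfl, by norm_num⟩ ⟨by norm_num, le_rfl⟩ (by norm_num))

/-- Jensen's inequality on the interval where `logPsi2` is concave. -/
lemma sum_logPsi2_le_of_le_seven_eighths {n : ℕ} (hn : 0 < n) {β : Fin n → ℝ} {s : ℝ}
    (hβ : ∀ k, β k ∈ Set.Ioc (0 : ℝ) (7 / 8)) (hsum : ∑ k, β k = s) :
    ∑ k, logPsi2 (β k) ≤ n * logPsi2 (s / n) := by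
  have hn' : (0 : ℝ) < n := Nat.cast_pos.2 hn
  have h := concaveOn_logPsi2.le_map_sum (t := Finset.univ) (w := fun _ : Fin n => (n : ℝ)⁻¹)
    (p := β) (fun _ _ => by positivity) (by simp [hn'.ne']) (fun k _ => hβ k)
  simp only [smul_eq_mul, ← Finset.mul_sum, hsum] at h
  rwa [inv_mul_le_iff₀ hn', inv_mul_eq_div] at h

lemma sum_logPsi2_le {n : ℕ} (hn : 2 ≤ n) {β : Fin n → ℝ} (hpos : ∀ k, 0 < β k)
    (hsum : ∑ k, β k = √2) : ∑ k, logPsi2 (β k) ≤ n * logPsi2 (√2 / n) := by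
  by_cases! hsmall : ∀ k, β k ≤ 7 / 8
  · exact sum_logPsi2_le_of_le_seven_eighths (by omega) (fun k => ⟨hpos k, hsmall k⟩) hsum
  -- Move the excess of the large coordinate over `7 / 8` to another coordinate.
  obtain ⟨k, hk⟩ := hsmall
  have : Nontrivial (Fin n) := Fin.nontrivial_iff_two_le.2 hn
  obtain ⟨j, hj⟩ := exists_ne k
  have hhi : √2 ≤ 1.415 := sqrt_le_iff.2 ⟨by norm_num, by norm_num⟩
  have hpair : ∀ i, i ≠ k → β i + β k ≤ √2 := fun i hi => by
    rw [← hsum, ← Finset.sum_pair hi]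
    exact Finset.sum_le_sum_of_subset_of_nonneg (Finset.subset_univ _) fun l _ _ => (hpos l).le
  have hkle : β k ≤ √2 := by linarith [hpair j hj, hpos j]
  set d := β k - 7 / 8 with hd
  let γ : Fin n → ℝ := fun i => β i - (if i = k then d else 0) + (if i = j then d else 0)
  have hγk : γ k = 7 / 8 := by simp [γ, hj.symm, hd]
  have hγj : γ j = β j + d := by simp [γ, hj]
  have hγ : ∀ i, i ≠ k → i ≠ j → γ i = β i := fun i hi hi' => by simp [γ, hi, hi']
  have hγsum : ∑ i, γ i = √2 := by
    simp [γ, Finset.sum_add_distrib, Finset.sum_sub_distrib, hsum]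
  have hγmem : ∀ i, γ i ∈ Set.Ioc (0 : ℝ) (7 / 8) := fun i => by
    by_cases hi : i = k
    · rw [hi, hγk]
      norm_num
    · have h1 := hpair i hi
      have h2 := hpos i
      by_cases hi' : i = j
      · subst hi'
        rw [hγj]
        constructor <;> linarith
      · rw [hγ i hi hi']
        constructor <;> linarith
  refine le_trans (Finset.sum_le_sum fun i _ => ?_)
    (sum_logPsi2_le_of_le_seven_eighths (by omega) hγmem hγsum)
  by_cases hi : i = k
  · rw [hi, hγk]
    exact logPsi2_le_seven_eighths hk.le hkle
  · by_cases hi' : i = j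
    · subst hi'
      have h1 := hpair i hi
      have h2 := hpos i
      rw [hγj]
      exact monotoneOn_logPsi2 ⟨h2, by linarith⟩ ⟨by linarith, by linarith⟩ (by linarith)
    · rw [hγ i hi hi']

theorem psi2_prod_le (n : ℕ) (hn : 2 ≤ n) (β : Fin n → ℝ)
    (hβ : ∀ k, β k ∈ Set.Ioo (0 : ℝ) (Real.sqrt 2)) (hsum : ∑ k, β k = Real.sqrt 2) :
    ∏ k, Psi2 (β k) ≤ (Psi2 (Real.sqrt 2 / n)) ^ n := by
  have hn' : (0 : ℝ) < n := Nat.cast_pos.2 (by omega)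
  rw [Finset.prod_congr rfl fun k _ => psi2_eq_exp_logPsi2 (hβ k).1,
    psi2_eq_exp_logPsi2 (by positivity), ← exp_sum, ← exp_nat_mul]
  exact exp_le_exp.2 (sum_logPsi2_le hn (fun k => (hβ k).1) hsum)
end

section
/- There exists a real number β₀ with 1.32 < β₀ < 1.33 such that the function F₁ is strictly decreasing on the interval (0, β₀] and strictly increasing on the interval [β₀, 2). -/
open Real

/-- F₁(β) = 2β·log(2β) + 2/β + (2−β)·log(2−β) − (2+β)·log(2+β). -/
noncomputable def F1 (β : ℝ) : ℝ :=
  2 * β * Real.log (2 * β) + 2 / β + (2 - β) * Real.log (2 - β)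
    - (2 + β) * Real.log (2 + β)

open Set

/-- The derivative of `F1` on `(0, 2)`. -/
noncomputable def F1Deriv (β : ℝ) : ℝ :=
  2 * Real.log (2 * β) - 2 / β ^ 2 - Real.log (2 - β) - Real.log (2 + β)

theorem hasDerivAt_F1 {β : ℝ} (h0 : 0 < β) (h2 : β < 2) : HasDerivAt F1 (F1Deriv β) β := by
  have hβ : β ≠ 0 := h0.ne'
  have hsub : 2 - β ≠ 0 := by linarith
  have hadd : 2 + β ≠ 0 := by linarith
  have d1 : HasDerivAt (fun x : ℝ => 2 * x) 2 β := by
    simpa using (hasDerivAt_id β).const_mul (2 : ℝ)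
  have d2 : HasDerivAt (fun x : ℝ => 2 - x) (-1) β := (hasDerivAt_id β).const_sub 2
  have d3 : HasDerivAt (fun x : ℝ => 2 + x) 1 β := (hasDerivAt_id β).const_add 2
  have d4 : HasDerivAt (fun x : ℝ => 2 / x) (2 * -(β ^ 2)⁻¹) β := by
    simpa only [div_eq_mul_inv] using (hasDerivAt_inv hβ).const_mul (2 : ℝ)
  refine ((((d1.mul (d1.log (by positivity))).add d4).add (d2.mul (d2.log hsub))).sub
    (d3.mul (d3.log hadd))).congr_deriv ?_
  unfold F1Deriv
  field_simp
  ring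

theorem strictMonoOn_F1Deriv : StrictMonoOn F1Deriv (Ioo 0 2) := by
  rintro x ⟨hx0, hx2⟩ y ⟨hy0, hy2⟩ hxy
  have l1 : Real.log (2 * x) < Real.log (2 * y) := Real.log_lt_log (by linarith) (by linarith)
  have l2 : Real.log (4 - y ^ 2) < Real.log (4 - x ^ 2) :=
    Real.log_lt_log (by nlinarith) (by nlinarith)
  have factor : ∀ z : ℝ, 0 < z → z < 2 →
      Real.log (4 - z ^ 2) = Real.log (2 - z) + Real.log (2 + z) := by
    intro z hz0 hz2
    rw [← Real.log_mul (by linarith) (by linarith)]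
    ring_nf
  rw [factor x hx0 hx2, factor y hy0 hy2] at l2
  have l3 : 2 / y ^ 2 < 2 / x ^ 2 := by gcongr
  unfold F1Deriv
  linarith

theorem F1Deriv_eq_log_sub {β : ℝ} (h0 : 0 < β) (h2 : β < 2) :
    F1Deriv β = Real.log (4 * β ^ 2 / (4 - β ^ 2)) - 2 / β ^ 2 := by
  have hsub : 2 - β ≠ 0 := by linarith
  have hadd : 2 + β ≠ 0 := by linarith
  rw [show 4 * β ^ 2 / (4 - β ^ 2) = (2 * β) ^ 2 / ((2 - β) * (2 + β)) by ring_nf,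
    Real.log_div (by positivity) (mul_ne_zero hsub hadd), Real.log_pow, Real.log_mul hsub hadd]
  unfold F1Deriv
  push_cast
  ring

theorem F1Deriv_neg : F1Deriv 1.32 < 0 := by
  rw [F1Deriv_eq_log_sub (by norm_num) (by norm_num), sub_neg,
    Real.log_lt_iff_lt_exp (by norm_num)]
  have h := Real.add_one_le_exp (2 / 1.32 ^ 2 - 1 : ℝ)
  have e := Real.exp_one_gt_d9
  calc (4 * 1.32 ^ 2 / (4 - 1.32 ^ 2) : ℝ) < 2.7182818283 * (2 / 1.32 ^ 2 - 1 + 1) := by norm_num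
    _ ≤ Real.exp 1 * Real.exp (2 / 1.32 ^ 2 - 1) := by gcongr
    _ = Real.exp (2 / 1.32 ^ 2) := by rw [← Real.exp_add]; ring_nf

theorem F1Deriv_pos : 0 < F1Deriv 1.33 := by
  rw [F1Deriv_eq_log_sub (by norm_num) (by norm_num), sub_pos,
    Real.lt_log_iff_exp_lt (by norm_num)]
  have h := Real.add_one_le_exp (1 - 2 / 1.33 ^ 2 : ℝ)
  have e := Real.exp_one_lt_d9
  have hmul : Real.exp (2 / 1.33 ^ 2) * Real.exp (1 - 2 / 1.33 ^ 2) = Real.exp 1 := by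
    rw [← Real.exp_add]; ring_nf
  have hpos := Real.exp_pos (2 / 1.33 ^ 2)
  norm_num at *
  nlinarith

theorem continuousOn_F1Deriv : ContinuousOn F1Deriv (Ioo 0 2) := by
  unfold F1Deriv
  fun_prop (disch := rintro x ⟨h0, h2⟩; first | positivity | linarith)

theorem F1_monotonicity :
    ∃ β₀ : ℝ, 1.32 < β₀ ∧ β₀ < 1.33 ∧
      StrictAntiOn F1 (Set.Ioc 0 β₀) ∧ StrictMonoOn F1 (Set.Ico β₀ 2) := by
  obtain ⟨β₀, ⟨hl, hu⟩, hroot⟩ := intermediate_value_Ioo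
    (show (1.32 : ℝ) ≤ 1.33 by norm_num)
    (continuousOn_F1Deriv.mono (Icc_subset_Ioo (by norm_num) (by norm_num)))
    (show (0 : ℝ) ∈ Ioo (F1Deriv 1.32) (F1Deriv 1.33) from ⟨F1Deriv_neg, F1Deriv_pos⟩)
  have h0 : 0 < β₀ := lt_trans (by norm_num) hl
  have h2 : β₀ < 2 := hu.trans (by norm_num)
  refine ⟨β₀, hl, hu, strictAntiOn_of_deriv_neg (convex_Ioc _ _) ?_ ?_,
    strictMonoOn_of_deriv_pos (convex_Ico _ _) ?_ ?_⟩
  · exact fun x hx => (hasDerivAt_F1 hx.1 (hx.2.trans_lt h2)).continuousAt.continuousWithinAt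
  · rw [interior_Ioc]
    rintro x ⟨hx0, hx⟩
    rw [(hasDerivAt_F1 hx0 (hx.trans h2)).deriv, ← hroot]
    exact strictMonoOn_F1Deriv ⟨hx0, hx.trans h2⟩ ⟨h0, h2⟩ hx
  · exact fun x hx => (hasDerivAt_F1 (h0.trans_le hx.1) hx.2).continuousAt.continuousWithinAt
  · rw [interior_Ico]
    rintro x ⟨hx, hx2⟩
    rw [(hasDerivAt_F1 (h0.trans hx) hx2).deriv, ← hroot]
    exact strictMonoOn_F1Deriv ⟨h0, h2⟩ ⟨h0.trans hx, hx2⟩ hx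
end

section
/- For every β with 0 < β < 1 one has F₁(β) − F₁(2−β) > 0, i.e., F₁(β) > F₁(2−β). -/
open Real

theorem F1_gt_reflection (β : ℝ) (h0 : 0 < β) (h1 : β < 1) :
    F1 β > F1 (2 - β) := by
  obtain ⟨t, rfl⟩ : ∃ t, β = 1 - t := ⟨1 - β, by ring⟩
  have ht0 : 0 < t := by linarith
  have ht1 : t < 1 := by linarith
  have log_one_sub : -t ≤ (1 - t) * log (1 - t) := by
    have h := mul_le_mul_of_nonneg_left (one_sub_inv_le_log_of_pos h0) h0.le
    rw [mul_sub, mul_inv_cancel₀ h0.ne'] at h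
    linarith
  have log_one_add : (1 + t) * log (1 + t) ≤ (1 + t) * t := by
    gcongr
    linarith [log_le_sub_one_of_pos (show 0 < 1 + t by linarith)]
  have log_three_mono : log (3 - t) ≤ log (3 + t) :=
    log_le_log (by linarith) (by linarith)
  have log_three_sum : t * (3 * log 2) ≤ t * (log (3 + t) + log (3 - t)) := by
    gcongr
    rw [← log_mul (by linarith) (by linarith), show 3 * log 2 = log (2 ^ 3) by simp]
    exact log_le_log (by norm_num) (by nlinarith)
  have inv_diff : 4 * t * (1 + t ^ 2) ≤ 2 / (1 - t) - 2 / (1 + t) := by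
    rw [div_sub_div _ _ h0.ne' (by linarith), le_div_iff₀ (by positivity)]
    nlinarith [pow_pos ht0 5]
  have log_two : t * log 2 ≤ t * 0.7 := by
    gcongr
    linarith [log_two_lt_d9]
  have quadratic : 0 < t * (1.3 - t + 4 * t ^ 2) :=
    mul_pos ht0 (by nlinarith [sq_nonneg (t - 1 / 8)])
  unfold F1
  rw [show 2 - (2 - (1 - t)) = 1 - t by ring, show 2 - (1 - t) = 1 + t by ring,
    show 2 + (1 - t) = 3 - t by ring, show 2 + (1 + t) = 3 + t by ring,
    log_mul two_ne_zero h0.ne', log_mul two_ne_zero (by linarith)]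
  linarith
end

section
/- Let n ≥ 2 be a natural number and let β₁, …, βₙ be real numbers with βₖ ∈ (0,2) for all k, β₁ + ⋯ + βₙ = 2, and F₁(β_i) = F₁(β_j) for all i, j (the Lagrange stationarity condition). Then βₖ = 2/n for every k. -/
open Real

theorem hasDerivAt_F1_s4 {x : ℝ} (hx : x ∈ Set.Ioo (0 : ℝ) 2) :
    HasDerivAt F1 (2 * log (2 * x) - 2 / x ^ 2 - log (2 - x) - log (2 + x)) x := by
  obtain ⟨h0, h2⟩ := hx
  have hid := hasDerivAt_id' x
  have hdouble := hid.const_mul 2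
  have hsub := hid.const_sub 2
  have hadd := hid.const_add 2
  have hsub_ne : 2 - x ≠ 0 := by linarith
  have hadd_ne : 2 + x ≠ 0 := by linarith
  have h := (((hdouble.mul (hdouble.log (by positivity))).add
    ((hasDerivAt_const x (2 : ℝ)).div hid h0.ne')).add
    (hsub.mul (hsub.log hsub_ne))).sub (hadd.mul (hadd.log hadd_ne))
  refine h.congr_deriv ?_
  field_simp
  ring

theorem strictAntiOn_F1 : StrictAntiOn F1 (Set.Ioc 0 1) := by
  have hmem : ∀ x ∈ Set.Ioc (0 : ℝ) 1, x ∈ Set.Ioo (0 : ℝ) 2 :=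
    fun x hx => ⟨hx.1, by linarith [hx.2]⟩
  refine strictAntiOn_of_deriv_neg (convex_Ioc 0 1)
    (fun x hx => (hasDerivAt_F1_s4 (hmem x hx)).continuousAt.continuousWithinAt) fun x hx => ?_
  rw [interior_Ioc] at hx
  obtain ⟨h0, h1⟩ := hx
  rw [(hasDerivAt_F1_s4 ⟨h0, by linarith⟩).deriv]
  have hdouble : log (2 * x) ≤ log 2 := log_le_log (by positivity) (by linarith)
  have hsub : 0 ≤ log (2 - x) := log_nonneg (by linarith)
  have hadd : 0 ≤ log (2 + x) := log_nonneg (by linarith)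
  have hinv : 2 ≤ 2 / x ^ 2 := by
    rw [le_div_iff₀ (by positivity)]
    nlinarith
  linarith [log_two_lt_d9]

/-- On the right half of `(0, 2)`, `F1` lies below its reflection about `1`. -/
theorem F1_lt_F1_two_sub {b : ℝ} (h1 : 1 < b) (h2 : b < 2) : F1 b < F1 (2 - b) := by
  have hderiv : ∀ x ∈ Set.Ico (1 : ℝ) 2, HasDerivAt (fun y => F1 (2 - y) - F1 y)
      (-(2 * log (2 * (2 - x)) - 2 / (2 - x) ^ 2 - log (2 - (2 - x)) - log (2 + (2 - x)))
        - (2 * log (2 * x) - 2 / x ^ 2 - log (2 - x) - log (2 + x))) x := by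
    rintro x ⟨hx1, hx2⟩
    exact ((hasDerivAt_F1_s4 (x := 2 - x) ⟨by linarith, by linarith⟩).comp_const_sub 2 x).sub
      (hasDerivAt_F1_s4 ⟨by linarith, hx2⟩)
  have hmono : StrictMonoOn (fun y => F1 (2 - y) - F1 y) (Set.Ico 1 2) := by
    refine strictMonoOn_of_deriv_pos (convex_Ico 1 2)
      (fun x hx => (hderiv x hx).continuousAt.continuousWithinAt) fun x hx => ?_
    rw [interior_Ico] at hx
    rw [(hderiv x ⟨hx.1.le, hx.2⟩).deriv]
    obtain ⟨hx1, hx2⟩ := hx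
    have hpos : 0 < 2 - x := by linarith
    rw [log_mul two_ne_zero hpos.ne', log_mul two_ne_zero (by linarith : x ≠ 0), sub_sub_cancel]
    have hinv : 2 ≤ 2 / (2 - x) ^ 2 := by
      rw [le_div_iff₀ (by positivity)]
      nlinarith
    have hinv' : 0 < 2 / x ^ 2 := by positivity
    have hlog : log x ≤ x - 1 := log_le_sub_one_of_pos (by linarith)
    have hlog' : log (2 - x) ≤ 2 - x - 1 := log_le_sub_one_of_pos hpos
    have hadd : log 2 ≤ log (2 + (2 - x)) := log_le_log two_pos (by linarith)
    have hadd' : log 2 ≤ log (2 + x) := log_le_log two_pos (by linarith)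
    linarith [log_two_lt_d9]
  have h := hmono ⟨le_rfl, one_lt_two⟩ ⟨h1.le, h2⟩ h1
  norm_num at h
  exact h

theorem F1_stationary_implies_equal (n : ℕ) (hn : 2 ≤ n) (β : Fin n → ℝ)
    (hβ : ∀ k, β k ∈ Set.Ioo (0 : ℝ) 2) (hsum : ∑ k, β k = 2)
    (hstat : ∀ i j, F1 (β i) = F1 (β j)) :
    ∀ k, β k = 2 / n := by
  have hpos : ∀ k, 0 < β k := fun k => (hβ k).1
  have hle : ∀ k, β k ≤ 1 := by
    intro i
    by_contra! hi
    have : Nontrivial (Fin n) := Fin.nontrivial_iff_two_le.mpr hn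
    obtain ⟨j, hji⟩ := exists_ne i
    have hpair : β i + β j ≤ 2 := by
      rw [← hsum, ← Finset.sum_pair hji.symm]
      exact Finset.sum_le_sum_of_subset_of_nonneg (Finset.subset_univ _)
        fun k _ _ => (hpos k).le
    have hanti : F1 (2 - β i) ≤ F1 (β j) :=
      strictAntiOn_F1.antitoneOn ⟨hpos j, by linarith⟩
        ⟨by linarith [(hβ i).2], by linarith⟩ (by linarith)
    linarith [F1_lt_F1_two_sub hi (hβ i).2, hstat i j]
  intro k
  have heq : ∀ j, β j = β k := fun j =>
    strictAntiOn_F1.injOn ⟨hpos j, hle j⟩ ⟨hpos k, hle k⟩ (hstat j k)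
  have hn0 : (n : ℝ) ≠ 0 := by positivity
  rw [eq_div_iff hn0, ← hsum, Finset.sum_congr rfl fun j _ => heq j]
  simp [mul_comm]
end
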